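/- arXiv:2007.01179 — 2 statements merged into one kernel-verified Lean document; each statement's English description precedes it below -/
import Mathlib

section
/- Let X and C be nonempty finite types, let p be a probability mass function on X × C with marginals p_X on X and p_C on C, and assume p_X x > 0 and p_C c > 0 for all x, c. Let N ≥ 1 be a natural number and let f : X × C → ℝ be any strictly positive critic function. Consider the random experiment where (x₁, c) is drawn from p and x₂, …, x_N are drawn i.i.d. from p_X, independently of (x₁, c). Then the mutual information of p is lower-bounded by log N minus the expected InfoNCE loss: ∑_{(x,c)} p (x, c) * Real.log (p (x, c) / (p_X x * p_C c)) ≥ Real.log N − E[ −Real.log ( f (x₁, c) / ∑_{i=1}^{N} f (x_i, c) ) ], where the expectation is the finite sum over the joint distribution of (x₁, c, x₂, …, x_N) described above. -/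
open Finset in
/-- By exchangeability of i.i.d. draws, every coordinate carries on average the fraction
`1 / (m + 1)` of the total score. -/
theorem sum_prod_mul_score_ratio_eq_one {X : Type*} [Fintype X] (w g : X → ℝ) (m : ℕ)
    (hw : ∑ x, w x = 1) (hg : ∀ x, 0 < g x) :
    ∑ x : X, ∑ xs : Fin m → X, (w x * ∏ i, w (xs i)) *
      (((m + 1 : ℕ) : ℝ) * (g x / (g x + ∑ i, g (xs i)))) = 1 := by
  let A : Fin (m + 1) → ℝ := fun j =>
    ∑ y : Fin (m + 1) → X, (∏ i, w (y i)) * (g (y j) / ∑ i, g (y i))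
  have hA : ∀ j, A j = A 0 := fun j => by
    refine Fintype.sum_equiv ((Equiv.swap 0 j).arrowCongr (Equiv.refl X)) _ _ fun y => ?_
    simp only [Equiv.arrowCongr_apply, Equiv.coe_refl, Function.comp_apply, id, Equiv.symm_swap,
      Equiv.swap_apply_left]
    rw [Equiv.prod_comp (Equiv.swap 0 j) fun i => w (y i),
      Equiv.sum_comp (Equiv.swap 0 j) fun i => g (y i)]
  have hsum : ∑ j, A j = 1 := by
    calc ∑ j, A j = ∑ y : Fin (m + 1) → X, ∏ i, w (y i) := by
          rw [sum_comm]
          refine sum_congr rfl fun y _ => ?_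
          have hpos : 0 < ∑ i, g (y i) := sum_pos (fun i _ => hg _) univ_nonempty
          rw [← mul_sum, ← sum_div, div_self hpos.ne', mul_one]
      _ = 1 := by
          classical
          rw [← Fintype.piFinset_univ, ← prod_univ_sum]
          simp [hw]
  have hA0 : A 0 = ∑ x : X, ∑ xs : Fin m → X, (w x * ∏ i, w (xs i)) *
      (g x / (g x + ∑ i, g (xs i))) := by
    rw [← Fintype.sum_prod_type']
    refine (Fintype.sum_equiv (Fin.consEquiv fun _ : Fin (m + 1) => X) _ _ fun z => ?_).symm
    simp [Fin.consEquiv, Fin.prod_univ_succ, Fin.sum_univ_succ]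
  calc _ = ((m + 1 : ℕ) : ℝ) * A 0 := by
        rw [hA0, mul_sum]
        refine sum_congr rfl fun x _ => ?_
        rw [mul_sum]
        exact sum_congr rfl fun xs _ => by ring
    _ = 1 := by
        rw [← hsum, sum_congr rfl fun j _ => hA j]
        simp

/-- The pointwise form of Gibbs' inequality. -/
theorem sub_le_mul_log_sub_log {a d t : ℝ} (ha : 0 ≤ a) (hd : 0 < d) (ht : 0 < t) :
    a - d * t ≤ a * (Real.log (a / d) - Real.log t) := by
  rcases ha.eq_or_lt with rfl | ha
  · simp only [zero_sub, zero_mul, Left.neg_nonpos_iff]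
    positivity
  · have h := Real.log_le_sub_one_of_pos (x := d * t / a) (by positivity)
    have hlog : Real.log (d * t / a) = -(Real.log (a / d) - Real.log t) := by
      rw [Real.log_div (by positivity) ha.ne', Real.log_mul hd.ne' ht.ne',
        Real.log_div ha.ne' hd.ne']
      ring
    rw [hlog] at h
    have h' := mul_le_mul_of_nonneg_left h ha.le
    rw [mul_sub, mul_div_cancel₀ _ ha.ne'] at h'
    linarith


/-- **InfoNCE lower bound on mutual information (finite case).**
Let `X` and `C` be nonempty finite types, `p` a probability mass function on `X × C`
with marginals `pX` and `pC` which are everywhere positive, `N ≥ 1`, and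
`f : X × C → ℝ` a strictly positive critic.  In the experiment where `(x₁, c)` is drawn
from `p` and the negatives `x₂, …, x_N` (here `xs : Fin (N - 1) → X`) are drawn i.i.d.
from `pX` independently of `(x₁, c)`, the mutual information of `p` is lower-bounded by
`log N` minus the expected InfoNCE loss `E[−log (f (x₁, c) / ∑_{i=1}^N f (x_i, c))]`,
the expectation being the finite sum over the joint distribution of `(x₁, c, xs)`. -/
theorem mutualInfo_ge_log_sub_infoNCE
    {X C : Type*} [Fintype X] [Fintype C] [Nonempty X] [Nonempty C]
    (p : X × C → ℝ) (pX : X → ℝ) (pC : C → ℝ) (N : ℕ) (f : X × C → ℝ)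
    (hp : ∀ z, 0 ≤ p z) (hpsum : ∑ z : X × C, p z = 1)
    (hpX : ∀ x, pX x = ∑ c : C, p (x, c)) (hpC : ∀ c, pC c = ∑ x : X, p (x, c))
    (hpXpos : ∀ x, 0 < pX x) (hpCpos : ∀ c, 0 < pC c)
    (hN : 1 ≤ N) (hf : ∀ z, 0 < f z) :
    ∑ x : X, ∑ c : C, p (x, c) * Real.log (p (x, c) / (pX x * pC c))
      ≥ Real.log (N : ℝ)
        - ∑ x₁ : X, ∑ c : C, ∑ xs : Fin (N - 1) → X,
            (p (x₁, c) * ∏ i : Fin (N - 1), pX (xs i)) *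
              (-Real.log (f (x₁, c) / (f (x₁, c) + ∑ i : Fin (N - 1), f (xs i, c)))) := by
  obtain ⟨m, rfl⟩ : ∃ m, N = m + 1 := ⟨N - 1, by omega⟩
  have hpX1 : ∑ x, pX x = 1 := by
    simp only [hpX, ← hpsum, Fintype.sum_prod_type]
  have hpC1 : ∑ c, pC c = 1 := by
    simp only [hpC, ← hpsum, Fintype.sum_prod_type_right]
  have hprod : ∑ xs : Fin m → X, ∏ i, pX (xs i) = 1 := by
    classical
    rw [← Fintype.piFinset_univ, ← Finset.prod_univ_sum]
    simp [hpX1]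
  have hp1 : ∑ x, ∑ c, p (x, c) = 1 := by rw [← hpsum, Fintype.sum_prod_type]
  let h : X → C → (Fin m → X) → ℝ := fun x c xs => f (x, c) / (f (x, c) + ∑ i, f (xs i, c))
  have hh : ∀ x c xs, 0 < h x c xs := fun x c xs =>
    div_pos (hf _) (add_pos_of_pos_of_nonneg (hf _) (Finset.sum_nonneg fun i _ => (hf _).le))
  have hmarg (F : X → C → ℝ) :
      ∑ x, ∑ c, ∑ xs : Fin m → X, (∏ i, pX (xs i)) * F x c = ∑ x, ∑ c, F x c := by
    simp only [← Finset.sum_mul, hprod, one_mul]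
  have hratio : ∑ x, ∑ c, ∑ xs : Fin m → X, (∏ i, pX (xs i)) *
      ((pX x * pC c) * (((m + 1 : ℕ) : ℝ) * h x c xs)) = 1 := by
    rw [Finset.sum_comm, ← hpC1]
    refine Finset.sum_congr rfl fun c _ => ?_
    have hc := congrArg (pC c * ·) <|
      sum_prod_mul_score_ratio_eq_one pX (fun x => f (x, c)) m hpX1 fun x => hf _
    simp only [mul_one] at hc
    refine Eq.trans ?_ hc
    rw [Finset.mul_sum]
    refine Finset.sum_congr rfl fun x _ => ?_
    rw [Finset.mul_sum]
    exact Finset.sum_congr rfl fun xs _ => by simp only [h]; ring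
  have key : ∑ x, ∑ c, ∑ xs : Fin m → X, (∏ i, pX (xs i)) *
        (p (x, c) - (pX x * pC c) * (((m + 1 : ℕ) : ℝ) * h x c xs))
      ≤ ∑ x, ∑ c, ∑ xs : Fin m → X, (∏ i, pX (xs i)) * (p (x, c) *
        (Real.log (p (x, c) / (pX x * pC c)) - Real.log (((m + 1 : ℕ) : ℝ) * h x c xs))) := by
    refine Finset.sum_le_sum fun x _ => Finset.sum_le_sum fun c _ =>
      Finset.sum_le_sum fun xs _ => mul_le_mul_of_nonneg_left ?_
        (Finset.prod_nonneg fun i _ => (hpXpos _).le)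
    exact sub_le_mul_log_sub_log (hp _) (mul_pos (hpXpos x) (hpCpos c))
      (mul_pos (by positivity) (hh x c xs))
  have hleft : ∑ x, ∑ c, ∑ xs : Fin m → X, (∏ i, pX (xs i)) *
      (p (x, c) - (pX x * pC c) * (((m + 1 : ℕ) : ℝ) * h x c xs)) = 0 := by
    simp only [mul_sub (∏ i, pX _), Finset.sum_sub_distrib]
    rw [hmarg fun x c => p (x, c), hp1, hratio, sub_self]
  have hright : ∑ x, ∑ c, ∑ xs : Fin m → X, (∏ i, pX (xs i)) * (p (x, c) *
        (Real.log (p (x, c) / (pX x * pC c)) - Real.log (((m + 1 : ℕ) : ℝ) * h x c xs)))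
      = ∑ x, ∑ c, p (x, c) * Real.log (p (x, c) / (pX x * pC c))
        - Real.log ((m + 1 : ℕ) : ℝ)
        + ∑ x, ∑ c, ∑ xs : Fin m → X, (p (x, c) * ∏ i, pX (xs i)) * -Real.log (h x c xs) := by
    have hN' : ∑ x, ∑ c, p (x, c) * Real.log ((m + 1 : ℕ) : ℝ) = Real.log ((m + 1 : ℕ) : ℝ) := by
      simp only [← Finset.sum_mul, hp1, one_mul]
    rw [← hN', ← hmarg fun x c => p (x, c) * Real.log (p (x, c) / (pX x * pC c)),
      ← hmarg fun x c => p (x, c) * Real.log ((m + 1 : ℕ) : ℝ)]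
    simp only [← Finset.sum_sub_distrib, ← Finset.sum_add_distrib]
    refine Finset.sum_congr rfl fun x _ => Finset.sum_congr rfl fun c _ =>
      Finset.sum_congr rfl fun xs _ => ?_
    rw [Real.log_mul (by positivity) (hh x c xs).ne']
    ring
  rw [hleft, hright] at key
  have bound : Real.log ((m + 1 : ℕ) : ℝ)
      - ∑ x, ∑ c, ∑ xs : Fin m → X, (p (x, c) * ∏ i, pX (xs i)) * -Real.log (h x c xs)
      ≤ ∑ x, ∑ c, p (x, c) * Real.log (p (x, c) / (pX x * pC c)) := by linarith
  exact bound
end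

section
/- Let X and Y be nonempty finite types, let p be a probability mass function on X × Y with marginals p_X on X and p_Y on Y, and assume p (x, y) > 0 for all x, y. Let N ≥ 1 and consider the experiment where (x₁, y) is drawn from p and x₂, …, x_N are drawn i.i.d. from p_X independently of (x₁, y). Define the expected InfoNCE loss of a strictly positive critic f : X × Y → ℝ as L(f) = E[ −Real.log ( f (x₁, y) / ∑_{i=1}^{N} f (x_i, y) ) ] (a finite sum over the joint distribution of (x₁, y, x₂, …, x_N)). Then the density-ratio critic f* defined by f* (x, y) = p (x, y) / (p_X x * p_Y y) is optimal: for every strictly positive critic f, L(f*) ≤ L(f). -/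
open scoped BigOperators

/-- Expected InfoNCE loss for a batch of `N` samples: the positive pair `(x₁, y)` is
drawn from the joint `p`, and `N - 1` negatives `xs : Fin (N - 1) → X` are drawn i.i.d.
from the marginal `pX`, independently of `(x₁, y)`.  The loss of the critic `f` is
`−log (f (x₁, y) / ∑_{i=1}^N f (x_i, y))`, and the expectation is the finite sum over
the joint distribution of `(x₁, y, xs)`. -/
noncomputable def expectedInfoNCE {X Y : Type*} [Fintype X] [Fintype Y] (N : ℕ)
    (p : X × Y → ℝ) (pX : X → ℝ) (f : X × Y → ℝ) : ℝ :=
  ∑ x₁ : X, ∑ y : Y, ∑ xs : Fin (N - 1) → X,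
    (p (x₁, y) * ∏ i : Fin (N - 1), pX (xs i)) *
      (-Real.log (f (x₁, y) / (f (x₁, y) + ∑ i : Fin (N - 1), f (xs i, y))))

/-- Gibbs' inequality for unnormalized positive weights. -/
lemma sum_mul_neg_log_div_sum_le {ι : Type*} [Fintype ι] [Nonempty ι] {r g : ι → ℝ}
    (hr : ∀ i, 0 < r i) (hg : ∀ i, 0 < g i) :
    ∑ j, r j * (-Real.log (r j / ∑ i, r i)) ≤ ∑ j, r j * (-Real.log (g j / ∑ i, g i)) := by
  have hR : 0 < ∑ i, r i := Finset.sum_pos (fun i _ => hr i) Finset.univ_nonempty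
  have hG : 0 < ∑ i, g i := Finset.sum_pos (fun i _ => hg i) Finset.univ_nonempty
  have key : ∀ j, r j * (-Real.log (r j / ∑ i, r i)) - r j * (-Real.log (g j / ∑ i, g i))
      ≤ g j * ((∑ i, r i) / ∑ i, g i) - r j := by
    intro j
    have hrj := hr j
    have hgj := hg j
    have hlog := Real.log_le_sub_one_of_pos
      (div_pos (div_pos hgj hG) (div_pos hrj hR))
    rw [Real.log_div (div_pos hgj hG).ne' (div_pos hrj hR).ne'] at hlog
    calc _ = r j * (Real.log (g j / ∑ i, g i) - Real.log (r j / ∑ i, r i)) := by ring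
      _ ≤ r j * (g j / (∑ i, g i) / (r j / ∑ i, r i) - 1) :=
        mul_le_mul_of_nonneg_left hlog hrj.le
      _ = _ := by field_simp
  have hsum := Finset.sum_le_sum fun j (_ : j ∈ Finset.univ) => key j
  rw [Finset.sum_sub_distrib, Finset.sum_sub_distrib, ← Finset.sum_mul,
    mul_div_cancel₀ _ hG.ne'] at hsum
  linarith

/-- Exchangeability of i.i.d. samples: the distinguished sample may be averaged over all
positions of the batch. -/
lemma card_mul_sum_eq_sum_symmetrized {X : Type*} [Fintype X] (n : ℕ) (q r g : X → ℝ) :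
    ((n : ℝ) + 1) * ∑ x : X, ∑ xs : Fin n → X, (q x * ∏ i, q (xs i)) *
        (r x * (-Real.log (g x / (g x + ∑ i, g (xs i)))))
      = ∑ z : Fin (n + 1) → X, (∏ i, q (z i)) *
          ∑ j, r (z j) * (-Real.log (g (z j) / ∑ i, g (z i))) := by
  have hcons : ∑ x : X, ∑ xs : Fin n → X, (q x * ∏ i, q (xs i)) *
        (r x * (-Real.log (g x / (g x + ∑ i, g (xs i)))))
      = ∑ z : Fin (n + 1) → X, (∏ i, q (z i)) *
          (r (z 0) * (-Real.log (g (z 0) / ∑ i, g (z i)))) := by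
    rw [← Fintype.sum_prod_type', ← (Fin.consEquiv fun _ => X).sum_comp]
    simp [Fin.consEquiv, Fin.prod_univ_succ, Fin.sum_univ_succ]
  have hswap : ∀ j : Fin (n + 1), ∑ z : Fin (n + 1) → X, (∏ i, q (z i)) *
          (r (z j) * (-Real.log (g (z j) / ∑ i, g (z i))))
      = ∑ z : Fin (n + 1) → X, (∏ i, q (z i)) *
          (r (z 0) * (-Real.log (g (z 0) / ∑ i, g (z i)))) := by
    intro j
    rw [← ((Equiv.swap 0 j).arrowCongr (Equiv.refl X)).sum_comp]
    refine Finset.sum_congr rfl fun z _ => ?_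
    have hq := Equiv.prod_comp (Equiv.swap 0 j) fun i => q (z i)
    have hg := Equiv.sum_comp (Equiv.swap 0 j) fun i => g (z i)
    simp [Equiv.arrowCongr, hq, hg]
  simp_rw [Finset.mul_sum (s := (Finset.univ : Finset (Fin (n + 1))))]
  rw [hcons, Finset.sum_comm, Finset.sum_congr rfl fun j _ => hswap j]
  simp

/-- The loss given `y`, with positives weighted by the ratio `r`, is minimized by `r`. -/
lemma sum_ratio_mul_neg_log_le {X : Type*} [Fintype X] (n : ℕ) {q r g : X → ℝ}
    (hq : ∀ x, 0 < q x) (hr : ∀ x, 0 < r x) (hg : ∀ x, 0 < g x) :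
    ∑ x : X, ∑ xs : Fin n → X, (q x * ∏ i, q (xs i)) *
        (r x * (-Real.log (r x / (r x + ∑ i, r (xs i)))))
      ≤ ∑ x : X, ∑ xs : Fin n → X, (q x * ∏ i, q (xs i)) *
        (r x * (-Real.log (g x / (g x + ∑ i, g (xs i))))) := by
  have hn : (0 : ℝ) < (n : ℝ) + 1 := by positivity
  rw [← mul_le_mul_iff_right₀ hn, card_mul_sum_eq_sum_symmetrized,
    card_mul_sum_eq_sum_symmetrized]
  refine Finset.sum_le_sum fun z _ => mul_le_mul_of_nonneg_left ?_
    (Finset.prod_nonneg fun i _ => (hq (z i)).le)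
  exact sum_mul_neg_log_div_sum_le (fun j => hr (z j)) fun j => hg (z j)

/-- **Optimality of the density-ratio critic for InfoNCE (finite case).**
Let `X`, `Y` be nonempty finite types, `p` an everywhere-positive probability mass
function on `X × Y` with marginals `pX`, `pY`, and `N ≥ 1`.  Then the density-ratio
critic `f* (x, y) = p (x, y) / (pX x * pY y)` minimizes the expected InfoNCE loss among
all strictly positive critics `f : X × Y → ℝ`. -/
theorem densityRatio_critic_optimal
    {X Y : Type*} [Fintype X] [Fintype Y] [Nonempty X] [Nonempty Y]
    (p : X × Y → ℝ) (pX : X → ℝ) (pY : Y → ℝ) (N : ℕ)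
    (hp : ∀ z, 0 < p z) (hpsum : ∑ z : X × Y, p z = 1)
    (hpX : ∀ x, pX x = ∑ y : Y, p (x, y)) (hpY : ∀ y, pY y = ∑ x : X, p (x, y))
    (hN : 1 ≤ N)
    (f : X × Y → ℝ) (hf : ∀ z, 0 < f z) :
    expectedInfoNCE N p pX (fun z => p z / (pX z.1 * pY z.2))
      ≤ expectedInfoNCE N p pX f := by
  have hpX' : ∀ x, 0 < pX x := fun x => by
    rw [hpX]; exact Finset.sum_pos (fun y _ => hp _) Finset.univ_nonempty
  have hpY' : ∀ y, 0 < pY y := fun y => by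
    rw [hpY]; exact Finset.sum_pos (fun x _ => hp _) Finset.univ_nonempty
  have hfactor : ∀ g : X × Y → ℝ, expectedInfoNCE N p pX g
      = ∑ y, pY y * ∑ x, ∑ xs : Fin (N - 1) → X, (pX x * ∏ i, pX (xs i)) *
          (p (x, y) / (pX x * pY y) *
            (-Real.log (g (x, y) / (g (x, y) + ∑ i, g (xs i, y))))) := by
    intro g
    rw [expectedInfoNCE, Finset.sum_comm]
    simp_rw [Finset.mul_sum]
    refine Finset.sum_congr rfl fun y _ => Finset.sum_congr rfl fun x _ =>
      Finset.sum_congr rfl fun xs _ => ?_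
    have hx := (hpX' x).ne'
    have hy := (hpY' y).ne'
    field_simp
  rw [hfactor, hfactor]
  refine Finset.sum_le_sum fun y _ => mul_le_mul_of_nonneg_left ?_ (hpY' y).le
  exact sum_ratio_mul_neg_log_le (N - 1) (r := fun x => p (x, y) / (pX x * pY y))
    (g := fun x => f (x, y)) hpX'
    (fun x => div_pos (hp _) (mul_pos (hpX' x) (hpY' y))) fun x => hf _
end
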